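/- arXiv:2602.19256 — 3 statements merged into one kernel-verified Lean document; each statement's English description precedes it below -/
import Mathlib

section
/- Let X be a regular curve and f : X → X a homeomorphism. Then every non-wandering point of f is recurrent, i.e., NW(f) = Rec(f). -/
open Filter Topology TopologicalSpace Set
open scoped ENNReal NNReal

variable {X : Type*}

/-- The regularity condition for a regular curve: every point has arbitrarily small open
neighbourhoods with finite topological boundary. (The requirement that `X` be a continuum,
i.e. a nonempty compact connected metric space, is imposed via instance arguments.) -/
def IsRegularCurve (X : Type*) [TopologicalSpace X] : Prop :=
  ∀ x : X, ∀ U : Set X, IsOpen U → x ∈ U →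
    ∃ V : Set X, IsOpen V ∧ x ∈ V ∧ V ⊆ U ∧ (frontier V).Finite

/-- A wandering point: some open neighbourhood `U` of `p` satisfies `f^n(U) ∩ U = ∅` for all
`n ≥ 1`. -/
def IsWanderingPoint [TopologicalSpace X] (f : X → X) (p : X) : Prop :=
  ∃ U : Set X, IsOpen U ∧ p ∈ U ∧ ∀ n : ℕ, 1 ≤ n → f^[n] '' U ∩ U = ∅

/-- A recurrent point: there is a strictly increasing sequence of positive integers `n_k`
with `f^{n_k}(x) → x`. -/
def IsRecurrentPoint [TopologicalSpace X] (f : X → X) (x : X) : Prop :=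
  ∃ u : ℕ → ℕ, StrictMono u ∧ (∀ k, 0 < u k) ∧
    Filter.Tendsto (fun k => f^[u k] x) Filter.atTop (nhds x)

section FrontierLemmas

theorem IsPreconnected.inter_frontier_nonempty_of_not_subset [TopologicalSpace X] {V s : Set X}
    (hV : IsPreconnected V) (h₁ : (V ∩ s).Nonempty) (h₂ : ¬ V ⊆ s) :
    (V ∩ frontier s).Nonempty := by
  by_contra hne
  have hmem : ∀ x ∈ V, x ∉ frontier s := fun x hx hf => hne ⟨x, hx, hf⟩
  obtain ⟨a, haV, has⟩ := h₁
  obtain ⟨b, hbV, hbs⟩ := not_subset.1 h₂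
  have key : ∀ x ∈ V, x ∈ interior s ∨ x ∈ (closure s)ᶜ := by
    intro x hx
    by_contra hcon
    push Not at hcon
    exact hmem x hx ⟨by simpa using hcon.2, hcon.1⟩
  obtain ⟨c, -, hc₁, hc₂⟩ := hV (interior s) (closure s)ᶜ isOpen_interior
    isClosed_closure.isOpen_compl key
    ⟨a, haV, (key a haV).resolve_right fun h => h (subset_closure has)⟩
    ⟨b, hbV, (key b hbV).resolve_left fun h => hbs (interior_subset h)⟩
  exact hc₂ (subset_closure (interior_subset hc₁))

theorem exists_mem_nhds_isPreconnected [TopologicalSpace X] [LocallyConnectedSpace X] {x : X}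
    {U : Set X} (hU : U ∈ 𝓝 x) : ∃ V ∈ 𝓝 x, V ⊆ U ∧ IsPreconnected V := by
  obtain ⟨V, ⟨hVo, hxV, hVc⟩, hVU⟩ :=
    (LocallyConnectedSpace.open_connected_basis x).mem_iff.1 hU
  exact ⟨V, hVo.mem_nhds hxV, hVU, hVc.isPreconnected⟩

theorem encard_frontier_union_add_inter_le [TopologicalSpace X] (s t : Set X) :
    (frontier (s ∪ t)).encard + (frontier (s ∩ t)).encard
      ≤ (frontier s).encard + (frontier t).encard := by
  rw [← encard_union_add_encard_inter, ← encard_union_add_encard_inter (frontier s)]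
  refine add_le_add (encard_le_encard ?_) (encard_le_encard ?_)
  · refine union_subset ((frontier_union_subset s t).trans ?_)
      ((frontier_inter_subset s t).trans ?_)
    · exact union_subset_union inter_subset_left inter_subset_right
    · exact union_subset_union inter_subset_left inter_subset_right
  · rintro x ⟨⟨hx₁, hx₂⟩, ⟨hx₃, hx₄⟩⟩
    have hs : x ∈ closure s := closure_mono inter_subset_left hx₃
    have ht : x ∈ closure t := closure_mono inter_subset_right hx₃
    exact ⟨⟨hs, fun h => hx₂ (interior_mono subset_union_left h)⟩,
      ⟨ht, fun h => hx₂ (interior_mono subset_union_right h)⟩⟩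

/-- A pointwise limit of sets with at most `r` frontier points has at most `r` frontier points. -/
theorem encard_frontier_le_of_pointwise_limit [TopologicalSpace X] [T2Space X]
    [LocallyConnectedSpace X] {ι : Type*} {l : Filter ι} [NeBot l] {Z : ι → Set X} {W : Set X}
    (hZ : ∀ x, ∀ᶠ i in l, (x ∈ Z i ↔ x ∈ W)) {r : ℕ}
    (hr : ∀ᶠ i in l, (frontier (Z i)).encard ≤ r) : (frontier W).encard ≤ r := by
  by_contra! hlt
  have hle : ((r + 1 : ℕ) : ℕ∞) ≤ (frontier W).encard := by
    push_cast
    exact Order.add_one_le_of_lt hlt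
  obtain ⟨T, hTW, hT⟩ := exists_subset_encard_eq hle
  have hTfin : T.Finite := finite_of_encard_eq_coe hT
  obtain ⟨U, hU, hdisj⟩ := hTfin.t2_separation
  choose V hV hVU hVc using fun x => exists_mem_nhds_isPreconnected ((hU x).2.mem_nhds (hU x).1)
  have hmeet : ∀ᶠ i in l, ∀ t ∈ T, (V t ∩ frontier (Z i)).Nonempty := by
    rw [hTfin.eventually_all]
    intro t ht
    have ht' := hTW ht
    obtain ⟨a, haV, haW⟩ := mem_closure_iff_nhds.1 ht'.1 _ (hV t)
    have hnot : ¬ V t ⊆ W := fun h => ht'.2 (mem_interior_iff_mem_nhds.2 (mem_of_superset (hV t) h))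
    obtain ⟨b, hbV, hbW⟩ := not_subset.1 hnot
    filter_upwards [hZ a, hZ b] with i hia hib
    exact (hVc t).inter_frontier_nonempty_of_not_subset ⟨a, haV, hia.2 haW⟩
      fun h => hbW (hib.1 (h hbV))
  obtain ⟨i, hi, hir⟩ := (hmeet.and hr).exists
  choose! g hgV hgF using hi
  have hinj : InjOn g T := by
    intro a ha b hb hab
    by_contra hne
    exact disjoint_left.1 (hdisj ha hb hne) (hVU a (hgV a ha)) (hab ▸ hVU b (hgV b hb))
  have h1 := encard_le_encard_of_injOn (t := frontier (Z i)) hgF hinj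
  rw [hT] at h1
  have h2 := h1.trans hir
  norm_cast at h2
  omega

theorem exists_mem_mapClusterPt_of_finite [TopologicalSpace X] {ι : Type*} {l : Filter ι}
    {F : Set X} (hF : F.Finite) {u : ι → X → X} {y : X}
    (h : ∀ V ∈ 𝓝 y, ∃ᶠ i in l, ∃ q ∈ F, u i q ∈ V) :
    ∃ q ∈ F, MapClusterPt y l (fun i => u i q) := by
  by_contra! hcon
  simp only [mapClusterPt_iff_frequently, not_forall, not_frequently] at hcon
  choose! V hV hVu using hcon
  refine h (⋂ q ∈ F, V q) ((biInter_mem hF).2 hV) ?_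
  filter_upwards [(hF.eventually_all).2 hVu] with i hi
  rintro ⟨q, hq, hqV⟩
  exact hi q hq (mem_iInter₂.1 hqV q hq)

end FrontierLemmas

theorem IsRegularCurve.exists_isOpen_closure_subset [TopologicalSpace X] [RegularSpace X]
    (hX : IsRegularCurve X) {x : X} {U : Set X} (hU : U ∈ 𝓝 x) :
    ∃ W : Set X, IsOpen W ∧ x ∈ W ∧ closure W ⊆ U ∧ (frontier W).Finite := by
  obtain ⟨C, hC, hCc, hCU⟩ := exists_mem_nhds_isClosed_subset hU
  obtain ⟨W, hWo, hxW, hWC, hWf⟩ := hX x (interior C) isOpen_interior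
    (mem_interior_iff_mem_nhds.2 hC)
  exact ⟨W, hWo, hxW, (closure_minimal (hWC.trans interior_subset) hCc).trans hCU, hWf⟩

theorem IsRegularCurve.locallyConnectedSpace [TopologicalSpace X] [T2Space X] [CompactSpace X]
    [ConnectedSpace X] (hX : IsRegularCurve X) : LocallyConnectedSpace X := by
  rw [locallyConnectedSpace_iff_connected_subsets]
  intro x U hU
  obtain ⟨W, hWo, hxW, hWU, hWf⟩ := hX.exists_isOpen_closure_subset hU
  have : CompactSpace (closure W) := isCompact_iff_compactSpace.1 isClosed_closure.isCompact
  let x' : closure W := ⟨x, subset_closure hxW⟩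
  have hclopen : ∀ e : closure W, e ∉ connectedComponent x' →
      ∃ G : Set (closure W), IsClopen G ∧ x' ∈ G ∧ e ∉ G := by
    intro e he
    rw [connectedComponent_eq_iInter_isClopen] at he
    simp only [mem_iInter, not_forall] at he
    obtain ⟨⟨G, hG, hxG⟩, heG⟩ := he
    exact ⟨G, hG, hxG, heG⟩
  choose! G hG hxG heG using hclopen
  let E : Set (closure W) := {e | (e : X) ∈ frontier W ∧ e ∉ connectedComponent x'}
  have hE : E.Finite :=
    (hWf.preimage Subtype.val_injective.injOn).subset fun e he => he.1
  let H : Set (closure W) := ⋂ e ∈ E, G e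
  have hH : IsClopen H := hE.isClopen_biInter fun e he => hG e he.2
  have hHC : H ⊆ connectedComponent x' := by
    intro z hz
    by_contra hzC
    let L : Set (closure W) := H \ G z
    have hL : IsClopen L := hH.diff (hG z hzC)
    have hLW : ∀ w ∈ L, (w : X) ∈ W := by
      rintro w ⟨hwH, hwG⟩
      by_contra hwW
      have hwf : (w : X) ∈ frontier W := by
        rw [hWo.frontier_eq]
        exact ⟨w.2, hwW⟩
      by_cases hwC : w ∈ connectedComponent x'
      · exact hwG ((hG z hzC).connectedComponent_subset (hxG z hzC) hwC)
      · exact heG w hwC (mem_iInter₂.1 hwH w ⟨hwf, hwC⟩)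
    have hLclosed : IsClosed (Subtype.val '' L : Set X) :=
      isClosed_closure.isClosedMap_subtype_val _ hL.1
    have hLopen : IsOpen (Subtype.val '' L : Set X) := by
      obtain ⟨O, hO, hOL⟩ := isOpen_induced_iff.1 hL.2
      have : (Subtype.val '' L : Set X) = W ∩ O := by
        ext w
        constructor
        · rintro ⟨w, hw, rfl⟩
          exact ⟨hLW w hw, by rw [← hOL] at hw; exact hw⟩
        · rintro ⟨hwW, hwO⟩
          exact ⟨⟨w, subset_closure hwW⟩, by rw [← hOL]; exact hwO, rfl⟩
      rw [this]
      exact hWo.inter hO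
    have huniv := IsClopen.eq_univ ⟨hLclosed, hLopen⟩ ⟨z, z, ⟨hz, heG z hzC⟩, rfl⟩
    obtain ⟨w, hw, hwx⟩ : x ∈ (Subtype.val '' L : Set X) := huniv ▸ mem_univ x
    have : w = x' := Subtype.ext hwx
    exact hw.2 (this ▸ hxG z hzC)
  refine ⟨Subtype.val '' connectedComponent x', ?_,
    isPreconnected_connectedComponent.image _ continuous_subtype_val.continuousOn, ?_⟩
  · obtain ⟨O, hO, hOH⟩ := isOpen_induced_iff.1 hH.2
    have hxH : x' ∈ H := mem_iInter₂.2 fun e he => hxG e he.2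
    have hxO : x ∈ O := by rw [← hOH] at hxH; exact hxH
    refine mem_of_superset ((hWo.inter hO).mem_nhds ⟨hxW, hxO⟩) ?_
    rintro w ⟨hwW, hwO⟩
    exact ⟨⟨w, subset_closure hwW⟩, hHC (by rw [← hOH]; exact hwO), rfl⟩
  · rintro w ⟨w, -, rfl⟩
    exact hWU w.2

section Cuts

/-- An open set whose closure misses `M`, so that its frontier cuts it off from `M`. -/
def IsCut [TopologicalSpace X] (M O : Set X) : Prop :=
  IsOpen O ∧ Disjoint (closure O) M

/-- Cutting `A` off from `M` takes at least `r` frontier points. -/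
def CutBound [TopologicalSpace X] (M A : Set X) (r : ℕ) : Prop :=
  ∀ O, IsCut M O → A ⊆ O → (r : ℕ∞) ≤ (frontier O).encard

theorem IsCut.union [TopologicalSpace X] {M O O' : Set X} (h : IsCut M O) (h' : IsCut M O') :
    IsCut M (O ∪ O') :=
  ⟨h.1.union h'.1, by rw [closure_union]; exact h.2.union_left h'.2⟩

theorem IsCut.inter_left [TopologicalSpace X] {M O O' : Set X} (h : IsCut M O) (h' : IsOpen O') :
    IsCut M (O ∩ O') :=
  ⟨h.1.inter h', h.2.mono_left (closure_mono inter_subset_left)⟩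

theorem IsCut.preimage [TopologicalSpace X] {M O : Set X} (h : IsCut M O) (g : X ≃ₜ X)
    (hg : g ⁻¹' M = M) : IsCut M (g ⁻¹' O) :=
  ⟨h.1.preimage g.continuous, by
    rw [← g.preimage_closure, ← hg]
    exact h.2.preimage g⟩

theorem Homeomorph.encard_frontier_preimage [TopologicalSpace X] (g : X ≃ₜ X) (O : Set X) :
    (frontier (g ⁻¹' O)).encard = (frontier O).encard := by
  rw [← g.preimage_frontier, ← g.image_symm, g.symm.injective.encard_image]

theorem Homeomorph.zpow_preimage_eq [TopologicalSpace X] {f : X ≃ₜ X} {M : Set X}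
    (hM : f ⁻¹' M = M) (k : ℤ) : (f ^ k : X ≃ₜ X) ⁻¹' M = M := by
  induction k with
  | zero => rw [zpow_zero]; rfl
  | succ n ih =>
    rw [zpow_add_one]
    change f ⁻¹' ((f ^ (n : ℤ) : X ≃ₜ X) ⁻¹' M) = M
    rw [ih, hM]
  | pred n ih =>
    rw [zpow_sub_one]
    change f.symm ⁻¹' ((f ^ (-(n : ℤ)) : X ≃ₜ X) ⁻¹' M) = M
    rw [ih]
    conv_lhs => rw [← hM]
    ext x
    simp

/-- Submodularity of the number of frontier points: unions of minimal cuts are minimal cuts. -/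
theorem CutBound.encard_frontier_union_le [TopologicalSpace X] {M A O O' : Set X} {r : ℕ}
    (hr : CutBound M A r) (h : IsCut M O) (h' : IsCut M O') (hA : A ⊆ O) (hA' : A ⊆ O')
    (hO : (frontier O).encard ≤ r) (hO' : (frontier O').encard ≤ r) :
    (frontier (O ∪ O')).encard ≤ r := by
  have h1 := encard_frontier_union_add_inter_le O O'
  have h2 := hr _ (h.inter_left h'.1) (subset_inter hA hA')
  have h3 : (frontier (O ∪ O')).encard + r ≤ (r : ℕ∞) + r :=
    (add_le_add le_rfl h2).trans (h1.trans (add_le_add hO hO'))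
  exact (ENat.add_le_add_iff_right (ENat.natCast_ne_top r)).1 h3

theorem exists_isCut_cutBound [TopologicalSpace X] [RegularSpace X] (hX : IsRegularCurve X)
    {M : Set X} (hM : IsClosed M) {y : X} (hy : y ∉ M) :
    ∃ r : ℕ, CutBound M {y} r ∧ ∃ B, IsCut M B ∧ y ∈ B ∧ (frontier B).encard ≤ r := by
  classical
  have hex : ∃ r : ℕ, ∃ B, IsCut M B ∧ y ∈ B ∧ (frontier B).encard ≤ r := by
    obtain ⟨W, hWo, hyW, hWM, hWf⟩ := hX.exists_isOpen_closure_subset (hM.isOpen_compl.mem_nhds hy)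
    exact ⟨(frontier W).ncard, W, ⟨hWo, disjoint_left.2 fun x hx => hWM hx⟩, hyW,
      hWf.cast_ncard_eq.ge⟩
  refine ⟨Nat.find hex, fun O hO hyO => ?_, Nat.find_spec hex⟩
  by_contra! hlt
  obtain ⟨n, hn⟩ := ENat.ne_top_iff_exists.1 (hlt.trans_le le_top).ne
  rw [← hn, Nat.cast_lt] at hlt
  exact Nat.find_min hex hlt ⟨O, hO, hyO rfl, hn.ge⟩

/-- If some point is asymptotic to `y` along an ultrafilter of iterates, then a finite set of such
points is as hard to cut off from an invariant set `M` as `y` is. -/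
theorem exists_finite_cutBound [TopologicalSpace X] [T2Space X] [LocallyConnectedSpace X]
    {f : X ≃ₜ X} {M : Set X} (hM : f ⁻¹' M = M) {y : X} {r : ℕ} (hr : CutBound M {y} r)
    {𝓕 : Ultrafilter ℕ} {p : X} (hp : Tendsto (fun n : ℕ => (f ^ (n : ℤ) : X ≃ₜ X) p) 𝓕 (𝓝 y)) :
    ∃ A : Set X, A.Finite ∧ (∀ a ∈ A, Tendsto (fun n : ℕ => (f ^ (n : ℤ) : X ≃ₜ X) a) 𝓕 (𝓝 y)) ∧
      CutBound M A r := by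
  classical
  by_contra! hcon
  let S : Set X := {a | Tendsto (fun n : ℕ => (f ^ (n : ℤ) : X ≃ₜ X) a) 𝓕 (𝓝 y)}
  have hex : ∃ t : ℕ, ∀ A : Set X, A.Finite → A ⊆ S →
      ∃ O, IsCut M O ∧ A ⊆ O ∧ (frontier O).encard < t := by
    refine ⟨r, fun A hA hAS => ?_⟩
    have h := hcon A hA hAS
    simp only [CutBound, not_forall, not_le] at h
    obtain ⟨O, hO, hAO, hlt⟩ := h
    exact ⟨O, hO, hAO, hlt⟩
  have hfind : ∀ A : Set X, A.Finite → A ⊆ S →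
      ∃ O, IsCut M O ∧ A ⊆ O ∧ (frontier O).encard < (Nat.find hex : ℕ) := Nat.find_spec hex
  have hfindr : Nat.find hex ≤ r := by
    refine Nat.find_min' hex fun A hA hAS => ?_
    have h := hcon A hA hAS
    simp only [CutBound, not_forall, not_le] at h
    obtain ⟨O, hO, hAO, hlt⟩ := h
    exact ⟨O, hO, hAO, hlt⟩
  have hmin : ∀ s : ℕ, s < Nat.find hex → ∃ A : Set X, A.Finite ∧ A ⊆ S ∧ CutBound M A s := by
    intro s hs
    have h := Nat.find_min hex hs
    push Not at h
    exact h
  obtain ⟨s, hs⟩ : ∃ s, Nat.find hex = s + 1 := by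
    refine Nat.exists_eq_succ_of_ne_zero fun h0 => ?_
    obtain ⟨O, -, -, hO⟩ := hfind ∅ finite_empty (empty_subset _)
    rw [h0] at hO
    simp at hO
  have hle : ∀ A : Set X, A.Finite → A ⊆ S →
      ∃ O, IsCut M O ∧ A ⊆ O ∧ (frontier O).encard ≤ s := by
    intro A hA hAS
    obtain ⟨O, hO, hAO, hlt⟩ := hfind A hA hAS
    rw [hs] at hlt
    push_cast at hlt
    exact ⟨O, hO, hAO, Order.le_of_lt_add_one hlt⟩
  obtain ⟨A₀, hA₀, hA₀S, hbound₀⟩ := hmin s (by omega)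
  let A := insert p A₀
  have hA : A.Finite := hA₀.insert p
  have hAS : A ⊆ S := insert_subset hp hA₀S
  have hbound : CutBound M A s := fun O hO hAO => hbound₀ O hO ((subset_insert _ _).trans hAO)
  let Fam := {O : Set X // IsCut M O ∧ A ⊆ O ∧ (frontier O).encard ≤ s}
  have : Nonempty Fam := by
    obtain ⟨O, hO⟩ := hle A hA hAS
    exact ⟨⟨O, hO⟩⟩
  have : IsDirectedOrder Fam := ⟨fun O₁ O₂ =>
    ⟨⟨O₁.1 ∪ O₂.1, O₁.2.1.union O₂.2.1, O₁.2.2.1.trans subset_union_left,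
      hbound.encard_frontier_union_le O₁.2.1 O₂.2.1 O₁.2.2.1 O₂.2.2.1 O₁.2.2.2 O₂.2.2.2⟩,
      show O₁.1 ⊆ O₁.1 ∪ O₂.1 from subset_union_left,
      show O₂.1 ⊆ O₁.1 ∪ O₂.1 from subset_union_right⟩⟩
  let W : Set X := ⋃ O : Fam, O.1
  have hWo : IsOpen W := isOpen_iUnion fun O => O.2.1.1
  have hWfin : (frontier W).encard ≤ s := by
    refine encard_frontier_le_of_pointwise_limit (l := (atTop : Filter Fam)) (Z := fun O => O.1)
      (fun x => ?_) (Eventually.of_forall fun O => O.2.2.2)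
    by_cases hx : x ∈ W
    · obtain ⟨O, hO⟩ := mem_iUnion.1 hx
      filter_upwards [eventually_ge_atTop O] with O' hO'
      exact ⟨fun _ => hx, fun _ => hO' hO⟩
    · exact Eventually.of_forall fun O => ⟨fun h => mem_iUnion.2 ⟨O, h⟩, fun h => absurd h hx⟩
  have hyW : ∀ n : ℤ, (f ^ n : X ≃ₜ X) y ∉ W := by
    intro n hn
    obtain ⟨O, hO⟩ := mem_iUnion.1 hn
    have h1 := hr _ (O.2.1.preimage (f ^ n) (Homeomorph.zpow_preimage_eq hM n))
      (singleton_subset_iff.2 hO)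
    rw [Homeomorph.encard_frontier_preimage] at h1
    have h2 := h1.trans O.2.2.2
    norm_cast at h2
    omega
  have hpW : p ∈ W := by
    obtain ⟨O⟩ := (inferInstance : Nonempty Fam)
    exact mem_iUnion.2 ⟨O, O.2.2.1 (mem_insert _ _)⟩
  obtain ⟨q, hqW, hq⟩ := exists_mem_mapClusterPt_of_finite (l := (𝓕 : Filter ℕ))
    (u := fun n : ℕ => (f ^ (n : ℤ) : X ≃ₜ X)) (y := y) (finite_of_encard_le_coe hWfin) (by
      intro V hV
      obtain ⟨V', hV', hV'V, hV'c⟩ := exists_mem_nhds_isPreconnected hV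
      refine Eventually.frequently ?_
      filter_upwards [hp hV'] with n hn
      have hc : IsPreconnected ((f ^ (n : ℤ) : X ≃ₜ X) ⁻¹' V') :=
        (Homeomorph.isPreconnected_preimage _).2 hV'c
      obtain ⟨q, hqV, hqW⟩ := hc.inter_frontier_nonempty_of_not_subset (s := W) ⟨p, hn, hpW⟩ (by
        intro hsub
        refine hyW (-n) (hsub ?_)
        change (f ^ (n : ℤ) : X ≃ₜ X) ((f ^ (-n : ℤ) : X ≃ₜ X) y) ∈ V'
        rw [← Homeomorph.mul_apply, ← zpow_add]
        simpa using mem_of_mem_nhds hV')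
      exact ⟨q, hqW, hV'V hqV⟩)
  have hqS : q ∈ S := by
    rw [mapClusterPt_iff_frequently] at hq
    intro V hV
    exact Ultrafilter.frequently_iff_eventually.1 (hq V hV)
  obtain ⟨O, hO, hAO, hOs⟩ := hle (insert q A) (hA.insert q) (insert_subset hqS hAS)
  have hqW' : q ∈ W :=
    mem_iUnion.2 ⟨⟨O, hO, (subset_insert _ _).trans hAO, hOs⟩, hAO (mem_insert _ _)⟩
  exact disjoint_left.1 (disjoint_frontier_iff_isOpen.2 hWo) hqW hqW'

/-- Some minimal cut of `y` contains both `y` and a forward iterate of `y`. -/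
theorem exists_isCut_mem_iterate_mem [TopologicalSpace X] [T2Space X] [LocallyConnectedSpace X]
    {f : X ≃ₜ X} {M : Set X} (hM : f ⁻¹' M = M) {y : X} {r : ℕ} (hr : CutBound M {y} r)
    {B : Set X} (hB : IsCut M B) (hyB : y ∈ B) (hBr : (frontier B).encard ≤ r)
    {p : X} (hp : MapClusterPt y atTop (fun n : ℕ => (f ^ (n : ℤ) : X ≃ₜ X) p)) :
    ∃ m : ℕ, 0 < m ∧ ∃ C, IsCut M C ∧ y ∈ C ∧ (f ^ (m : ℤ) : X ≃ₜ X) y ∈ C ∧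
      (frontier C).encard ≤ r := by
  obtain ⟨𝓕, h𝓕, hp𝓕⟩ := mapClusterPt_iff_ultrafilter.1 hp
  obtain ⟨A, hA, hAy, hbound⟩ := exists_finite_cutBound hM hr hp𝓕
  have hev : ∀ᶠ n : ℕ in (𝓕 : Filter ℕ), A ⊆ (f ^ (n : ℤ) : X ≃ₜ X) ⁻¹' B :=
    (hA.eventually_all).2 fun a ha => hAy a ha (hB.1.mem_nhds hyB)
  obtain ⟨n, hn⟩ := hev.exists
  obtain ⟨k, hk, hnk⟩ := (hev.and (h𝓕 (eventually_gt_atTop n))).exists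
  have hcut : ∀ j : ℤ, IsCut M ((f ^ j : X ≃ₜ X) ⁻¹' B) := fun j =>
    hB.preimage _ (Homeomorph.zpow_preimage_eq hM j)
  have hle : ∀ j : ℤ, (frontier ((f ^ j : X ≃ₜ X) ⁻¹' B)).encard ≤ r := fun j => by
    rwa [Homeomorph.encard_frontier_preimage]
  refine ⟨k - n, by omega,
    (f ^ (-k : ℤ) : X ≃ₜ X) ⁻¹' ((f ^ (n : ℤ) : X ≃ₜ X) ⁻¹' B ∪ (f ^ (k : ℤ) : X ≃ₜ X) ⁻¹' B),
    ((hcut _).union (hcut _)).preimage _ (Homeomorph.zpow_preimage_eq hM _), Or.inr ?_, Or.inl ?_,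
    ?_⟩
  · rw [mem_preimage, ← Homeomorph.mul_apply, ← zpow_add, add_neg_cancel, zpow_zero]
    exact hyB
  · have : (n : ℤ) + -k + ((k - n : ℕ) : ℤ) = 0 := by omega
    rw [mem_preimage, ← Homeomorph.mul_apply, ← Homeomorph.mul_apply, ← zpow_add, ← zpow_add, this,
      zpow_zero]
    exact hyB
  · rw [Homeomorph.encard_frontier_preimage]
    exact hbound.encard_frontier_union_le (hcut _) (hcut _) hn hk (hle _) (hle _)

end Cuts

section HittingSets

/-- The points that enter `B` after at most `n` applications of `g`. -/
def hittingSet (g : X → X) (B : Set X) (n : ℕ) : Set X :=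
  {w | ∃ k ≤ n, g^[k] w ∈ B}

theorem hittingSet_zero (g : X → X) (B : Set X) : hittingSet g B 0 = B := by
  ext w
  simp [hittingSet]

theorem hittingSet_succ (g : X → X) (B : Set X) (n : ℕ) :
    hittingSet g B (n + 1) = B ∪ g ⁻¹' hittingSet g B n := by
  ext w
  constructor
  · rintro ⟨k, hk, hw⟩
    cases k with
    | zero => exact Or.inl hw
    | succ k => exact Or.inr ⟨k, by omega, hw⟩
  · rintro (hw | ⟨k, hk, hw⟩)
    · exact ⟨0, by omega, hw⟩
    · exact ⟨k + 1, by omega, hw⟩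

theorem hittingSet_mono (g : X → X) (B : Set X) : Monotone (hittingSet g B) := by
  rintro m n hmn w ⟨k, hk, hw⟩
  exact ⟨k, hk.trans hmn, hw⟩

theorem subset_hittingSet (g : X → X) (B : Set X) (n : ℕ) : B ⊆ hittingSet g B n :=
  fun _ hw => ⟨0, n.zero_le, hw⟩

theorem IsCut.hittingSet [TopologicalSpace X] {M B : Set X} (hB : IsCut M B) (g : X ≃ₜ X)
    (hM : g ⁻¹' M = M) (n : ℕ) : IsCut M (hittingSet g B n) := by
  induction n with
  | zero => rwa [hittingSet_zero]
  | succ n ih =>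
    rw [hittingSet_succ]
    exact hB.union (ih.preimage g hM)

theorem encard_frontier_setOf_frequently_iterate_mem_le [TopologicalSpace X] [T2Space X]
    [LocallyConnectedSpace X] {h : X ≃ₜ X} {M : Set X} (hM : h ⁻¹' M = M) {y : X} {r : ℕ}
    (hr : CutBound M {y} r) {B : Set X} (hB : IsCut M B) (hyB : y ∈ B) (hhyB : h y ∈ B)
    (hBr : (frontier B).encard ≤ r) :
    (frontier {w | ∃ᶠ k in atTop, h^[k] w ∈ B}).encard ≤ r := by
  have hfin : ∀ n, (frontier (hittingSet h B n)).encard ≤ r := by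
    intro n
    induction n with
    | zero => rwa [hittingSet_zero]
    | succ n ih =>
      rw [hittingSet_succ]
      exact hr.encard_frontier_union_le hB ((hB.hittingSet h hM n).preimage h hM)
        (singleton_subset_iff.2 hyB) (singleton_subset_iff.2 (subset_hittingSet h B n hhyB)) hBr
        (by rwa [h.encard_frontier_preimage])
  have hC : (frontier {w | ∃ k, h^[k] w ∈ B}).encard ≤ r := by
    refine encard_frontier_le_of_pointwise_limit (l := atTop) (Z := hittingSet h B) (fun w => ?_)
      (Eventually.of_forall hfin)
    by_cases hw : ∃ k, h^[k] w ∈ B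
    · obtain ⟨k, hk⟩ := hw
      filter_upwards [eventually_ge_atTop k] with n hn
      exact ⟨fun _ => ⟨k, hk⟩, fun _ => ⟨k, hn, hk⟩⟩
    · exact Eventually.of_forall fun n => ⟨fun ⟨k, _, hk⟩ => ⟨k, hk⟩, fun hk => absurd hk hw⟩
  have hCl : ∀ l : ℕ, (frontier (h^[l] ⁻¹' {w | ∃ k, h^[k] w ∈ B})).encard ≤ r := by
    intro l
    induction l with
    | zero => exact hC
    | succ l ih =>
      rw [Function.iterate_succ, preimage_comp, h.encard_frontier_preimage]
      exact ih
  refine encard_frontier_le_of_pointwise_limit (l := atTop)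
    (Z := fun l => h^[l] ⁻¹' {w | ∃ k, h^[k] w ∈ B}) (fun w => ?_) (Eventually.of_forall hCl)
  by_cases hw : ∃ᶠ k in atTop, h^[k] w ∈ B
  · refine Eventually.of_forall fun l => ⟨fun _ => hw, fun _ => ?_⟩
    obtain ⟨k, hk, hkB⟩ := (frequently_atTop.1 hw) l
    refine ⟨k - l, ?_⟩
    rwa [← Function.iterate_add_apply, Nat.sub_add_cancel hk]
  · obtain ⟨N, hN⟩ := eventually_atTop.1 (not_frequently.1 hw)
    filter_upwards [eventually_ge_atTop N] with l hl
    refine ⟨fun ⟨k, hk⟩ => ?_, fun hk => absurd hk hw⟩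
    rw [← Function.iterate_add_apply] at hk
    exact absurd hk (hN _ (by omega))

theorem preimage_setOf_frequently_iterate_mem (h : X → X) (B : Set X) :
    h ⁻¹' {w | ∃ᶠ k in atTop, h^[k] w ∈ B} = {w | ∃ᶠ k in atTop, h^[k] w ∈ B} := by
  ext w
  change (∃ᶠ k in atTop, h^[k + 1] w ∈ B) ↔ ∃ᶠ k in atTop, h^[k] w ∈ B
  conv_rhs => rw [← map_add_atTop_eq_nat 1, frequently_map]

theorem exists_iterate_eq_self_of_finite {h : X → X} (hinj : Function.Injective h) {F : Set X}
    (hF : F.Finite) (hFF : h ⁻¹' F = F) {e : X} (he : e ∈ F) : ∃ c, 0 < c ∧ h^[c] e = e := by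
  have hmem : ∀ n, h^[n] e ∈ F := by
    intro n
    induction n with
    | zero => exact he
    | succ n ih =>
      rw [Function.iterate_succ_apply']
      rwa [← hFF] at ih
  obtain ⟨m, -, n, -, hne, hmn⟩ := infinite_univ.exists_ne_map_eq_of_mapsTo
    (f := fun n : ℕ => h^[n] e) (fun n _ => hmem n) hF
  rcases lt_or_gt_of_ne hne with hlt | hlt
  · exact ⟨n - m, by omega, Function.iterate_cancel hinj hmn.symm⟩
  · exact ⟨m - n, by omega, Function.iterate_cancel hinj hmn⟩

theorem iterate_preimage_eq {h : X → X} {K : Set X} (hK : h ⁻¹' K = K) (n : ℕ) :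
    h^[n] ⁻¹' K = K := by
  induction n with
  | zero => rfl
  | succ n ih => rw [Function.iterate_succ, preimage_comp, ih, hK]

/-- If all frontier points of `B₀` return to the closure of `B₀` in bounded time, then the forward
saturation of `B₀` is still cut off from `M`. -/
theorem disjoint_closure_iUnion_hittingSet [TopologicalSpace X] [LocallyConnectedSpace X]
    {h : X ≃ₜ X} {M : Set X} (hM : h ⁻¹' M = M) {B₀ : Set X} (hB₀ : IsCut M B₀) {N : ℕ}
    (hN : ∀ e ∈ frontier B₀, ∃ k, 0 < k ∧ k ≤ N ∧ h^[k] e ∈ closure B₀) :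
    Disjoint (closure (⋃ n, hittingSet h.symm B₀ n)) M := by
  have hM' : h.symm ⁻¹' M = M := by
    conv_lhs => rw [← hM]
    ext w
    simp
  have hcut := hB₀.hittingSet h.symm hM'
  have hiter : ∀ j : ℕ, IsOpen (h.symm^[j] ⁻¹' B₀) := fun j =>
    hB₀.1.preimage (h.symm.continuous.iterate j)
  have hclos : ∀ (j : ℕ) (s : Set X), closure (h.symm^[j] ⁻¹' s) = h.symm^[j] ⁻¹' closure s := by
    intro j s
    induction j with
    | zero => rfl
    | succ j ih => rw [Function.iterate_succ, preimage_comp, preimage_comp,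
        ← h.symm.preimage_closure, ih]
  have hstep : ∀ n, N ≤ n →
      frontier (hittingSet h.symm B₀ (n + 1)) ⊆ frontier (hittingSet h.symm B₀ n) := by
    intro n hn e he
    rw [(hcut (n + 1)).1.frontier_eq] at he
    rw [(hcut n).1.frontier_eq]
    refine ⟨?_, fun hen => he.2 (hittingSet_mono _ _ n.le_succ hen)⟩
    have hunion : hittingSet h.symm B₀ (n + 1)
        ⊆ hittingSet h.symm B₀ n ∪ h.symm^[n + 1] ⁻¹' B₀ := by
      rintro w ⟨k, hk, hw⟩
      rcases Nat.lt_or_ge n k with hlt | hle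
      · obtain rfl : k = n + 1 := by omega
        exact Or.inr hw
      · exact Or.inl ⟨k, hle, hw⟩
    have hcl := closure_mono hunion he.1
    rw [closure_union, hclos] at hcl
    rcases hcl with hcl | hcl
    · exact hcl
    · have hfr : h.symm^[n + 1] e ∈ frontier B₀ := by
        rw [hB₀.1.frontier_eq]
        exact ⟨hcl, fun hB => he.2 ⟨n + 1, le_rfl, hB⟩⟩
      obtain ⟨k, hk0, hkN, hk⟩ := hN _ hfr
      have heq : h^[k] (h.symm^[n + 1] e) = h.symm^[n + 1 - k] e := by
        obtain ⟨i, hi⟩ : ∃ i, n + 1 = k + i := ⟨n + 1 - k, by omega⟩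
        rw [hi, Nat.add_sub_cancel_left, Function.iterate_add_apply]
        exact Function.LeftInverse.iterate h.apply_symm_apply k _
      rw [heq] at hk
      have : e ∈ closure (h.symm^[n + 1 - k] ⁻¹' B₀) := by
        rw [hclos]
        exact hk
      have hsub : h.symm^[n + 1 - k] ⁻¹' B₀ ⊆ hittingSet h.symm B₀ n :=
        fun w hw => ⟨n + 1 - k, by omega, hw⟩
      exact closure_mono hsub this
  have hsub : ∀ n, N ≤ n →
      frontier (hittingSet h.symm B₀ n) ⊆ frontier (hittingSet h.symm B₀ N) := by
    intro n hn
    induction n, hn using Nat.le_induction with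
    | base => exact Subset.rfl
    | succ n hn ih => exact (hstep n hn).trans ih
  rw [disjoint_left]
  intro x hx hxM
  have hxn : ∀ n, x ∉ hittingSet h.symm B₀ n := fun n hn =>
    disjoint_left.1 (hcut n).2 (subset_closure hn) hxM
  have hxF : x ∉ frontier (hittingSet h.symm B₀ N) := fun hF =>
    disjoint_left.1 (hcut N).2 (frontier_subset_closure hF) hxM
  obtain ⟨V, hV, hVF, hVc⟩ := exists_mem_nhds_isPreconnected
    (isClosed_frontier.isOpen_compl.mem_nhds hxF)
  obtain ⟨a, haV, ha⟩ := mem_closure_iff_nhds.1 hx V hV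
  obtain ⟨n, hn⟩ := mem_iUnion.1 ha
  obtain ⟨q, hqV, hq⟩ := hVc.inter_frontier_nonempty_of_not_subset
    (s := hittingSet h.symm B₀ (max n N)) ⟨a, haV, hittingSet_mono _ _ (le_max_left _ _) hn⟩
    (fun hsub => hxn _ (hsub (mem_of_mem_nhds hV)))
  exact hVF hqV (hsub _ (le_max_right _ _) hq)

/-- A minimal cut of `y` from an invariant set `M` cannot contain both `y` and `h y` when `y` is a
non-periodic limit of a forward orbit and the backward orbit of `y` accumulates on `M`. -/
theorem false_of_isCut_of_apply_mem [TopologicalSpace X] [T2Space X] [LocallyConnectedSpace X]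
    {h : X ≃ₜ X} {M : Set X} (hM : h ⁻¹' M = M) {y : X} {r : ℕ} (hr : CutBound M {y} r)
    {B : Set X} (hB : IsCut M B) (hyB : y ∈ B) (hhyB : h y ∈ B) (hBr : (frontier B).encard ≤ r)
    {p : X} (hp : MapClusterPt y atTop (fun n => h^[n] p)) (hper : ∀ k, 0 < k → h^[k] y ≠ y)
    (hback : ∀ Z : Set X, IsClosed Z → (∀ k, h.symm^[k] y ∈ Z) → (Z ∩ M).Nonempty) : False := by
  rw [mapClusterPt_iff_frequently] at hp
  let K : Set X := {w | ∃ᶠ k in atTop, h^[k] w ∈ B}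
  have hKfin : (frontier K).Finite := finite_of_encard_le_coe
    (encard_frontier_setOf_frequently_iterate_mem_le hM hr hB hyB hhyB hBr)
  have hK : h ⁻¹' K = K := preimage_setOf_frequently_iterate_mem h B
  have hKfr : h ⁻¹' frontier K = frontier K := by rw [h.preimage_frontier, hK]
  have hKint : h ⁻¹' interior K = interior K := by rw [h.preimage_interior, hK]
  have hpK : ∀ n, h^[n] p ∈ K := fun n => by
    change p ∈ h^[n] ⁻¹' K
    rw [iterate_preimage_eq hK]
    exact hp B (hB.1.mem_nhds hyB)
  have hyK : y ∈ interior K := by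
    rw [← closure_sdiff_frontier]
    refine ⟨mem_closure_iff_nhds.2 fun V hV => ?_, fun hy => ?_⟩
    · obtain ⟨n, hn⟩ := (hp V hV).exists
      exact ⟨_, hn, hpK n⟩
    · obtain ⟨c, hc, hcy⟩ := exists_iterate_eq_self_of_finite h.injective hKfin hKfr hy
      exact hper c hc hcy
  let B₀ := B ∩ interior K
  have hB₀ : IsCut M B₀ := hB.inter_left isOpen_interior
  have hfr : frontier B₀ ⊆ frontier B ∪ frontier K :=
    (frontier_inter_subset _ _).trans (union_subset_union inter_subset_left
      (inter_subset_right.trans frontier_interior_subset))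
  have hfin : (frontier B₀).Finite := ((finite_of_encard_le_coe hBr).union hKfin).subset hfr
  have hret : ∀ e ∈ frontier B₀, ∃ k, 0 < k ∧ h^[k] e ∈ closure B₀ := by
    intro e he
    by_cases heK : e ∈ frontier K
    · obtain ⟨c, hc, hce⟩ := exists_iterate_eq_self_of_finite h.injective hKfin hKfr heK
      exact ⟨c, hc, hce.symm ▸ frontier_subset_closure he⟩
    · have hei : e ∈ interior K := by
        rw [← closure_sdiff_frontier]
        exact ⟨closure_mono (inter_subset_right.trans interior_subset)
          (frontier_subset_closure he), heK⟩
      have hef : ∃ᶠ k in atTop, h^[k] e ∈ B := interior_subset hei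
      obtain ⟨k, hk, hkB⟩ := frequently_atTop.1 hef 1
      refine ⟨k, hk, subset_closure ⟨hkB, ?_⟩⟩
      rwa [← iterate_preimage_eq hKint k] at hei
  obtain ⟨N, hN⟩ := ((hfin.eventually_all (l := atTop)
    (p := fun e N => ∃ k, 0 < k ∧ k ≤ N ∧ h^[k] e ∈ closure B₀)).2 fun e he => by
      obtain ⟨k, hk, hke⟩ := hret e he
      filter_upwards [eventually_ge_atTop k] with N hN
      exact ⟨k, hk, hN, hke⟩).exists
  let D : Set X := ⋃ n, hittingSet h.symm B₀ n
  have hD : Disjoint (closure D) M := disjoint_closure_iUnion_hittingSet hM hB₀ hN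
  have hforward : ∀ w ∈ D, h w ∈ D := by
    intro w hw
    obtain ⟨n, k, hk, hkw⟩ := mem_iUnion.1 hw
    refine mem_iUnion.2 ⟨k + 1, k + 1, le_rfl, ?_⟩
    rwa [Function.iterate_succ_apply, h.symm_apply_apply]
  obtain ⟨n₀, hn₀⟩ := (hp B₀ (hB₀.1.mem_nhds ⟨hyB, hyK⟩)).exists
  have hpD : ∀ n, n₀ ≤ n → h^[n] p ∈ D := by
    intro n hn
    induction n, hn using Nat.le_induction with
    | base => exact mem_iUnion.2 ⟨0, subset_hittingSet _ _ _ hn₀⟩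
    | succ n hn ih =>
      rw [Function.iterate_succ_apply']
      exact hforward _ ih
  obtain ⟨z, hzD, hzM⟩ := hback (closure D) isClosed_closure fun k => by
    refine mem_closure_iff_nhds.2 fun V hV => ?_
    obtain ⟨n, hn, hnV⟩ := frequently_atTop.1
      (hp _ ((h.symm.continuous.iterate k).continuousAt.preimage_mem_nhds hV)) (n₀ + k)
    have heq : h.symm^[k] (h^[n] p) = h^[n - k] p := by
      obtain ⟨i, rfl⟩ : ∃ i, n = k + i := ⟨n - k, by omega⟩
      rw [Nat.add_sub_cancel_left, Function.iterate_add_apply]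
      exact Function.LeftInverse.iterate h.symm_apply_apply k _
    rw [mem_preimage, heq] at hnV
    exact ⟨_, hnV, hpD _ (by omega)⟩
  exact disjoint_left.1 hD hzD hzM

end HittingSets

section Recurrence

theorem Homeomorph.iterate_zpow_apply [TopologicalSpace X] (g : X ≃ₜ X) (m : ℤ) (k : ℕ) (w : X) :
    (g ^ m : X ≃ₜ X)^[k] w = (g ^ (m * k) : X ≃ₜ X) w := by
  induction k with
  | zero =>
    rw [Nat.cast_zero, mul_zero, zpow_zero]
    rfl
  | succ k ih =>
    rw [Function.iterate_succ_apply', ih, ← Homeomorph.mul_apply, ← zpow_add]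
    push_cast
    ring_nf

theorem Homeomorph.zpow_natCast_apply [TopologicalSpace X] (g : X ≃ₜ X) (k : ℕ) (w : X) :
    (g ^ (k : ℤ) : X ≃ₜ X) w = g^[k] w := by
  simpa using (g.iterate_zpow_apply 1 k w).symm

/-- A non-wandering point that never returns close to itself is a limit of a backward orbit. -/
theorem exists_mapClusterPt_symm_iterate [TopologicalSpace X] [RegularSpace X]
    [LocallyConnectedSpace X] (hX : IsRegularCurve X) (f : X ≃ₜ X) {x : X}
    (hx : ¬ IsWanderingPoint f x) {U : Set X} (hU : U ∈ 𝓝 x) (hfU : ∀ n, 0 < n → f^[n] x ∉ U) :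
    ∃ q, MapClusterPt x atTop (fun n => f.symm^[n] q) := by
  obtain ⟨W, hWo, hxW, hWU, hWf⟩ := hX.exists_isOpen_closure_subset hU
  suffices h : ∃ q ∈ frontier W, MapClusterPt x atTop (fun n => f.symm^[n] q) by
    obtain ⟨q, -, hq⟩ := h
    exact ⟨q, hq⟩
  refine exists_mem_mapClusterPt_of_finite (u := fun n => f.symm^[n]) hWf fun V hV => ?_
  rw [frequently_atTop]
  intro N
  have hN : (⋂ k ∈ Finset.Icc 1 N, f^[k] ⁻¹' (closure W)ᶜ) ∈ 𝓝 x := by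
    refine (biInter_finset_mem _).2 fun k hk => ?_
    refine (f.continuous.iterate k).continuousAt.preimage_mem_nhds
      (isClosed_closure.isOpen_compl.mem_nhds fun hk' => ?_)
    exact hfU k (Finset.mem_Icc.1 hk).1 (hWU hk')
  obtain ⟨V', hV', hV'V, hV'c⟩ := exists_mem_nhds_isPreconnected
    (inter_mem (inter_mem hV (hWo.mem_nhds hxW)) hN)
  obtain ⟨n, hn, z, ⟨v, hv, rfl⟩, hz⟩ : ∃ n, 1 ≤ n ∧
      (f^[n] '' interior V' ∩ interior V').Nonempty := by
    by_contra! hcon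
    exact hx ⟨interior V', isOpen_interior, mem_interior_iff_mem_nhds.2 hV', hcon⟩
  have hzW : f^[n] v ∈ W := (hV'V (interior_subset hz)).1.2
  have hnN : N < n := by
    by_contra! hle
    exact mem_iInter₂.1 (hV'V (interior_subset hv)).2 n (Finset.mem_Icc.2 ⟨hn, hle⟩)
      (subset_closure hzW)
  have himage : IsPreconnected (f^[n] '' V') :=
    hV'c.image _ (f.continuous.iterate n).continuousOn
  obtain ⟨-, ⟨w, hw, rfl⟩, hwW⟩ := himage.inter_frontier_nonempty_of_not_subset
    ⟨_, mem_image_of_mem _ (interior_subset hv), hzW⟩ fun hsub =>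
      hfU n hn (hWU (subset_closure (hsub (mem_image_of_mem _ (mem_of_mem_nhds hV')))))
  refine ⟨n, hnN.le, _, hwW, ?_⟩
  rw [Function.LeftInverse.iterate f.symm_apply_apply n w]
  exact (hV'V hw).1.1

theorem exists_iterate_mem_of_not_isWanderingPoint [TopologicalSpace X] [T2Space X]
    [CompactSpace X] [ConnectedSpace X] (hX : IsRegularCurve X) (f : X ≃ₜ X) {x : X}
    (hx : ¬ IsWanderingPoint f x) {U : Set X} (hU : U ∈ 𝓝 x) : ∃ n, 0 < n ∧ f^[n] x ∈ U := by
  have := hX.locallyConnectedSpace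
  by_contra! hcon
  obtain ⟨U₀, hU₀U, hU₀, hxU₀⟩ := mem_nhds_iff.1 hU
  obtain ⟨q, hq⟩ := exists_mapClusterPt_symm_iterate hX f hx hU hcon
  let g : X ≃ₜ X := f.symm
  have hneg : ∀ i : ℤ, i < 0 → (g ^ i : X ≃ₜ X) x ∉ U₀ := by
    intro i hi hiU
    obtain ⟨n, hn, rfl⟩ : ∃ n : ℕ, 0 < n ∧ i = -n := ⟨i.natAbs, by omega, by omega⟩
    have hg : (g ^ (-n : ℤ) : X ≃ₜ X) = f ^ (n : ℤ) := by
      rw [zpow_neg, ← inv_zpow]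
      rfl
    rw [hg, Homeomorph.zpow_natCast_apply] at hiU
    exact hcon n hn (hU₀U hiU)
  let M : Set X := {w | ∀ n : ℤ, (g ^ n : X ≃ₜ X) w ∉ U₀}
  have hMclosed : IsClosed M := by
    have : M = ⋂ n : ℤ, (g ^ n : X ≃ₜ X) ⁻¹' U₀ᶜ := by
      ext w
      simp [M]
    rw [this]
    exact isClosed_iInter fun n => hU₀.isClosed_compl.preimage (g ^ n).continuous
  have hM : g ⁻¹' M = M := by
    ext w
    have hshift : ∀ n : ℤ, (g ^ n : X ≃ₜ X) (g w) = (g ^ (n + 1) : X ≃ₜ X) w := fun n => by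
      rw [zpow_add_one, Homeomorph.mul_apply]
    refine ⟨fun hw n => ?_, fun hw n => ?_⟩
    · have := hw (n - 1)
      rwa [hshift, sub_add_cancel] at this
    · rw [hshift]
      exact hw _
  have hxM : x ∉ M := fun h => h 0 (by
    rw [zpow_zero]
    exact hxU₀)
  obtain ⟨r, hr, B, hB, hxB, hBr⟩ := exists_isCut_cutBound hX hMclosed hxM
  obtain ⟨m, hm, C, hC, hxC, hmC, hCr⟩ := exists_isCut_mem_iterate_mem (f := g) hM hr hB hxB hBr
    (p := q) (by simpa only [Homeomorph.zpow_natCast_apply] using hq)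
  obtain ⟨p, -, hp⟩ := exists_mem_mapClusterPt_of_finite (l := atTop)
    (u := fun k => (g ^ (m : ℤ) : X ≃ₜ X)^[k]) (y := x)
    ((finite_Iio m).image fun j => g^[j] q) fun V hV => by
      rw [frequently_atTop]
      intro a
      obtain ⟨n, hn, hnV⟩ := frequently_atTop.1 (mapClusterPt_iff_frequently.1 hq V hV) (m * a)
      refine ⟨n / m, (Nat.le_div_iff_mul_le hm).2 (by rwa [mul_comm]), _,
        mem_image_of_mem _ (Nat.mod_lt n hm), ?_⟩
      rw [Homeomorph.iterate_zpow_apply, ← Nat.cast_mul, Homeomorph.zpow_natCast_apply,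
        ← Function.iterate_add_apply, Nat.div_add_mod]
      exact hnV
  have hmk : ∀ k : ℕ, 0 < k → (0 : ℤ) < m * k := fun k hk => by positivity
  refine false_of_isCut_of_apply_mem (Homeomorph.zpow_preimage_eq hM m) hr hC hxC hmC hCr hp
    (fun k hk hkx => ?_) fun Z hZ hkZ => ?_
  · rw [Homeomorph.iterate_zpow_apply] at hkx
    refine hneg (-(m * k)) (neg_lt_zero.2 (hmk k hk)) ?_
    nth_rewrite 1 [← hkx]
    rw [← Homeomorph.mul_apply, ← zpow_add, neg_add_cancel, zpow_zero]
    exact hxU₀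
  · have hsymm : ∀ k : ℕ, (g ^ (m : ℤ) : X ≃ₜ X).symm^[k] x = (g ^ (-m * k : ℤ) : X ≃ₜ X) x := by
      intro k
      rw [← Homeomorph.iterate_zpow_apply, zpow_neg]
      rfl
    obtain ⟨w, hw⟩ := exists_clusterPt_of_compactSpace
      (map (fun k => (g ^ (m : ℤ) : X ≃ₜ X).symm^[k] x) atTop)
    have hw' := mapClusterPt_iff_frequently.1 hw
    refine ⟨w, ?_, fun j hj => ?_⟩
    · by_contra hwZ
      obtain ⟨k, hk⟩ := (hw' _ (hZ.isOpen_compl.mem_nhds hwZ)).exists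
      exact hk (hkZ k)
    · obtain ⟨k, hk, hkU⟩ := frequently_atTop.1
        (hw' _ ((g ^ j).continuous.continuousAt.preimage_mem_nhds (hU₀.mem_nhds hj)))
        (j.natAbs + 1)
      rw [mem_preimage, hsymm, ← Homeomorph.mul_apply, ← zpow_add] at hkU
      refine hneg _ ?_ hkU
      have : (k : ℤ) ≤ m * k := le_mul_of_one_le_left (by positivity) (by exact_mod_cast hm)
      rw [neg_mul]
      omega

theorem isRecurrentPoint_of_forall_exists_iterate_mem [TopologicalSpace X]
    [FirstCountableTopology X] [T1Space X] {f : X → X} {x : X}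
    (h : ∀ U ∈ 𝓝 x, ∃ n, 0 < n ∧ f^[n] x ∈ U) : IsRecurrentPoint f x := by
  by_cases hper : ∃ n, 0 < n ∧ f^[n] x = x
  · obtain ⟨n, hn, hnx⟩ := hper
    refine ⟨fun k => n * (k + 1), fun a b hab => Nat.mul_lt_mul_of_pos_left (by omega) hn,
      fun k => by positivity, ?_⟩
    have : ∀ k, f^[n * (k + 1)] x = x := fun k => by
      rw [Function.iterate_mul]
      exact Function.iterate_fixed hnx _
    simp only [this]
    exact tendsto_const_nhds
  · push Not at hper
    have hcl : MapClusterPt x atTop (fun n => f^[n + 1] x) := by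
      rw [mapClusterPt_iff_frequently]
      intro V hV
      rw [frequently_atTop]
      intro N
      have hN : (⋂ k ∈ Finset.Icc 1 N, {f^[k] x}ᶜ) ∈ 𝓝 x :=
        (biInter_finset_mem _).2 fun k hk =>
          isOpen_compl_singleton.mem_nhds fun hx => hper k (Finset.mem_Icc.1 hk).1 hx.symm
      obtain ⟨n, hn, hnV, hnN⟩ := h _ (inter_mem hV hN)
      have hlt : N < n := by
        by_contra! hle
        exact mem_iInter₂.1 hnN n (Finset.mem_Icc.2 ⟨hn, hle⟩) rfl
      refine ⟨n - 1, by omega, ?_⟩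
      rwa [Nat.sub_add_cancel hn]
    obtain ⟨φ, hφ, hlim⟩ := hcl.tendsto_subseq
    exact ⟨fun k => φ k + 1, fun a b hab => Nat.succ_lt_succ (hφ hab), fun k => Nat.succ_pos _,
      hlim⟩

theorem IsRecurrentPoint.not_isWanderingPoint [TopologicalSpace X] {f : X → X} {x : X}
    (h : IsRecurrentPoint f x) : ¬ IsWanderingPoint f x := by
  rintro ⟨U, hU, hxU, hwand⟩
  obtain ⟨u, -, hpos, hlim⟩ := h
  obtain ⟨k, hk⟩ := (hlim.eventually_mem (hU.mem_nhds hxU)).exists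
  exact (hwand (u k) (hpos k)).subset ⟨mem_image_of_mem _ hxU, hk⟩

end Recurrence

/-- for a homeomorphism of a regular curve, the non-wandering set equals the set
of recurrent points: `NW(f) = Rec(f)`. -/
theorem nonwandering_eq_recurrent_of_isHomeomorph_of_isRegularCurve
    {X : Type*} [MetricSpace X] [CompactSpace X] [ConnectedSpace X] [Nonempty X]
    (hX : IsRegularCurve X) (f : X → X) (hf : IsHomeomorph f) :
    {x : X | ¬ IsWanderingPoint f x} = {x : X | IsRecurrentPoint f x} := by
  ext x
  refine ⟨fun hx => isRecurrentPoint_of_forall_exists_iterate_mem fun U hU => ?_,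
    IsRecurrentPoint.not_isWanderingPoint⟩
  exact exists_iterate_mem_of_not_isWanderingPoint hX (hf.homeomorph f) hx hU
end

section
/- Let X be a compact metric space and f : X → X a homeomorphism possessing a wandering point. Then the polynomial entropy of f satisfies h_pol(f) ≥ 1. -/
open Filter Topology TopologicalSpace Set
open scoped ENNReal NNReal

variable {X : Type*}

/-- The dynamical (Bowen) distance `d_n^f(x,y) = max_{0 ≤ k ≤ n-1} d(f^k x, f^k y)`. -/
noncomputable def dynDist [PseudoMetricSpace X] (f : X → X) (n : ℕ) (x y : X) : ℝ :=
  (((Finset.range n).sup fun k => nndist (f^[k] x) (f^[k] y) : ℝ≥0) : ℝ)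

/-- `E` is `(n, ε)`-separated for `f`: distinct points of `E` are at `d_n^f`-distance `≥ ε`. -/
def IsDynSeparated [PseudoMetricSpace X] (f : X → X) (n : ℕ) (ε : ℝ) (E : Set X) : Prop :=
  ∀ x ∈ E, ∀ y ∈ E, x ≠ y → ε ≤ dynDist f n x y

/-- `sep(n, ε)`: the maximal cardinality of a finite `(n, ε)`-separated set. -/
noncomputable def sepCount [PseudoMetricSpace X] (f : X → X) (n : ℕ) (ε : ℝ) : ℕ∞ :=
  ⨆ (E : Finset X) (_ : IsDynSeparated f n ε (E : Set X)), (E.card : ℕ∞)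

/-- `limsup_{n → ∞} log (u n) / log n`, valued in `[0, ∞]`. -/
noncomputable def polGrowth (u : ℕ → ℕ∞) : ℝ≥0∞ :=
  Filter.atTop.limsup fun n =>
    if u n = ⊤ then ⊤ else ENNReal.ofReal (Real.log ((u n).toNat : ℝ) / Real.log n)

/-- Polynomial entropy: `lim_{ε → 0⁺} limsup_{n → ∞} log sep(n,ε) / log n`; since the inner
quantity is antitone in `ε`, the limit as `ε → 0⁺` equals the supremum over `ε > 0`. -/
noncomputable def hpol [PseudoMetricSpace X] (f : X → X) : ℝ≥0∞ :=
  ⨆ (ε : ℝ) (_ : 0 < ε), polGrowth fun n => sepCount f n ε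

/-- The dynamical distance dominates the distance of any pair of iterates before time `n`. -/
theorem dist_iterate_le_dynDist [PseudoMetricSpace X] (f : X → X) {n k : ℕ} (hk : k < n)
    (x y : X) : dist (f^[k] x) (f^[k] y) ≤ dynDist f n x y := by
  rw [← coe_nndist, dynDist, NNReal.coe_le_coe]
  exact Finset.le_sup (f := fun k => nndist (f^[k] x) (f^[k] y)) (Finset.mem_range.2 hk)

/-- A finite indexed family that is pairwise separated bounds `sepCount` from below. -/
theorem le_sepCount_of_pairwise [PseudoMetricSpace X] (f : X → X) {n m : ℕ} {ε : ℝ} (x : ℕ → X)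
    (hinj : ∀ i j, i < j → x i ≠ x j)
    (hsep : ∀ i j, i < j → j < m → ε ≤ dynDist f n (x i) (x j)) :
    (m : ℕ∞) ≤ sepCount f n ε := by
  classical
  have hx : Function.Injective x := .of_lt_imp_ne hinj
  have hcomm (a b : X) : dynDist f n a b = dynDist f n b a := by
    simp only [dynDist, nndist_comm]
  have hE : IsDynSeparated f n ε ((Finset.range m).image x : Set X) := by
    intro a ha b hb hab
    simp only [Finset.coe_image, Finset.coe_range, mem_image, mem_Iio] at ha hb
    obtain ⟨i, hi, rfl⟩ := ha
    obtain ⟨j, hj, rfl⟩ := hb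
    rcases lt_trichotomy i j with h | rfl | h
    · exact hsep i j h hj
    · exact absurd rfl hab
    · rw [hcomm]
      exact hsep j i h hi
  calc (m : ℕ∞) = (((Finset.range m).image x).card : ℕ∞) := by
        rw [Finset.card_image_of_injective _ hx, Finset.card_range]
    _ ≤ sepCount f n ε :=
        le_iSup₂_of_le (f := fun (E : Finset X) (_ : IsDynSeparated f n ε (E : Set X)) =>
          (E.card : ℕ∞)) _ hE le_rfl

/-- A sequence growing at least linearly has polynomial growth at least `1`. -/
theorem one_le_polGrowth {u : ℕ → ℕ∞} (hu : ∀ n : ℕ, (n : ℕ∞) ≤ u n) : 1 ≤ polGrowth u := by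
  refine le_limsup_of_frequently_le (Eventually.frequently ?_)
  filter_upwards [eventually_ge_atTop 2] with n hn
  split_ifs with h
  · exact le_top
  · have hn' : n ≤ (u n).toNat := by
      have := ENat.toNat_le_toNat (hu n) h
      simpa using this
    have hn1 : (1 : ℝ) < n := by exact_mod_cast hn
    rw [ENNReal.one_le_ofReal, one_le_div (Real.log_pos hn1)]
    exact Real.log_le_log (by linarith) (by exact_mod_cast hn')

/-- a homeomorphism of a compact metric space possessing a wandering point has
polynomial entropy at least `1`. -/
theorem one_le_hpol_of_wandering
    {X : Type*} [MetricSpace X] [CompactSpace X]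
    (f : X → X) (hf : IsHomeomorph f) (p : X) (hp : IsWanderingPoint f p) :
    1 ≤ hpol f := by
  obtain ⟨U, hU, hpU, hw⟩ := hp
  obtain ⟨ε, hε, hball⟩ := Metric.isOpen_iff.1 hU p hpU
  obtain ⟨g, hg⟩ := hf.surjective.hasRightInverse
  have hfg (j : ℕ) : f^[j] (g^[j] p) = p := Function.LeftInverse.iterate hg j p
  have hnot (i j : ℕ) (hij : i < j) : f^[j] (g^[i] p) ∉ U := by
    intro h
    have hfi : f^[j] (g^[i] p) = f^[j - i] p := by
      rw [← Nat.sub_add_cancel hij.le, Function.iterate_add_apply, hfg, Nat.sub_add_cancel hij.le]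
    rw [hfi] at h
    have : f^[j - i] p ∈ f^[j - i] '' U ∩ U := ⟨mem_image_of_mem _ hpU, h⟩
    rw [hw (j - i) (by omega)] at this
    exact this
  refine le_iSup₂_of_le (f := fun (ε : ℝ) (_ : 0 < ε) => polGrowth fun n => sepCount f n ε)
    ε hε (one_le_polGrowth fun n => ?_)
  refine le_sepCount_of_pairwise f (fun j => g^[j] p) (fun i j hij h => ?_) fun i j hij hj => ?_
  · apply hnot i j hij
    rwa [h, hfg]
  · refine le_trans ?_ (dist_iterate_le_dynDist f hj _ _)
    by_contra! hlt
    rw [hfg] at hlt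
    exact hnot i j hij (hball hlt)
end

section
/- Let f : X → X be an equicontinuous continuous map of a compact metric space X. Then the induced map 2^f on the hyperspace of nonempty closed subsets of X with the Hausdorff metric is equicontinuous. -/
open Filter Topology TopologicalSpace Set
open scoped ENNReal NNReal

variable {X : Type*}

/-- The induced map `2^f : A ↦ f(A)` on the hyperspace of nonempty closed subsets of a compact
metric space (equivalently, nonempty compact subsets), with the Hausdorff metric. -/
noncomputable def hyperMap [TopologicalSpace X] (f : X → X) (hf : Continuous f) :
    NonemptyCompacts X → NonemptyCompacts X :=
  fun A => ⟨⟨f '' (A : Set X), A.isCompact.image hf⟩, A.nonempty.image f⟩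

theorem coe_hyperMap_iterate [TopologicalSpace X] (f : X → X) (hf : Continuous f) (n : ℕ)
    (A : NonemptyCompacts X) : ((hyperMap f hf)^[n] A : Set X) = f^[n] '' (A : Set X) := by
  induction n with
  | zero => simp
  | succ n ih =>
    rw [Function.iterate_succ_apply', Function.iterate_succ', image_comp, ← ih]
    rfl

/-- if `f` is an equicontinuous continuous map of a compact metric space, then
the induced map `2^f` on the hyperspace of nonempty closed subsets with the Hausdorff metric
is equicontinuous. -/
theorem hyperMap_equicontinuous_of_equicontinuous
    {X : Type*} [MetricSpace X] [CompactSpace X]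
    (f : X → X) (hf : Continuous f)
    (heq : ∀ ε : ℝ, 0 < ε → ∃ δ : ℝ, 0 < δ ∧ ∀ x y : X, dist x y < δ →
      ∀ n : ℕ, dist (f^[n] x) (f^[n] y) < ε) :
    ∀ ε : ℝ, 0 < ε → ∃ δ : ℝ, 0 < δ ∧
      ∀ A B : NonemptyCompacts X, dist A B < δ →
        ∀ n : ℕ, dist ((hyperMap f hf)^[n] A) ((hyperMap f hf)^[n] B) < ε := by
  intro ε hε
  obtain ⟨δ, hδ, h⟩ := heq (ε / 2) (half_pos hε)
  refine ⟨δ, hδ, fun A B hAB n => ?_⟩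
  have hfin : Metric.hausdorffEDist (A : Set X) B ≠ ⊤ :=
    Metric.hausdorffEDist_ne_top_of_nonempty_of_bounded A.nonempty B.nonempty
      A.isCompact.isBounded B.isCompact.isBounded
  rw [Metric.NonemptyCompacts.dist_eq] at hAB ⊢
  rw [coe_hyperMap_iterate, coe_hyperMap_iterate]
  refine (Metric.hausdorffDist_le_of_mem_dist (half_pos hε).le ?_ ?_).trans_lt (half_lt_self hε)
  · rintro _ ⟨x, hx, rfl⟩
    obtain ⟨y, hy, hxy⟩ := Metric.exists_dist_lt_of_hausdorffDist_lt hx hAB hfin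
    exact ⟨_, mem_image_of_mem _ hy, (h x y hxy n).le⟩
  · rintro _ ⟨y, hy, rfl⟩
    obtain ⟨x, hx, hxy⟩ := Metric.exists_dist_lt_of_hausdorffDist_lt' hy hAB hfin
    exact ⟨_, mem_image_of_mem _ hx, (h y x (by rwa [dist_comm]) n).le⟩
end
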